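/- Let d ≥ 2 and let A_1, …, A_d be positive semidefinite real symmetric d×d matrices. Then D(A_1, A_2, A_3, …, A_d)^2 ≥ D(A_1, A_1, A_3, …, A_d) · D(A_2, A_2, A_3, …, A_d). -/

import Mathlib

open Matrix

/-- The mixed discriminant of `d` real `d × d` matrices:
`D(A_1, …, A_d) = ∑_{S ⊆ {1,…,d}} (−1)^{d−|S|} det(∑_{i∈S} A_i)`. -/
noncomputable def mixedDiscriminant {d : ℕ} (A : Fin d → Matrix (Fin d) (Fin d) ℝ) : ℝ :=
  ∑ S : Finset (Fin d), (-1 : ℝ) ^ (d - S.card) * (∑ i ∈ S, A i).det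

section Inversion

variable {ι R : Type*} [Fintype ι] [DecidableEq ι] [CommRing R]

/-- The alternating sum over all sets containing a fixed set `T` vanishes unless `T` is full. -/
theorem sum_neg_one_pow_card_compl_of_subset (T : Finset ι) :
    (∑ S : Finset ι, if T ⊆ S then (-1 : R) ^ (Fintype.card ι - S.card) else 0) =
      if T = Finset.univ then 1 else 0 := by
  have h := Finset.prod_add (fun _ : ι => (1 : R)) (fun i => if i ∈ T then 0 else -1) Finset.univ
  have hl : (∏ i : ι, ((1 : R) + if i ∈ T then 0 else -1)) =
      if T = Finset.univ then 1 else 0 := by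
    split_ifs with hT
    · simp [hT]
    · obtain ⟨i, hi⟩ : ∃ i, i ∉ T := by
        simpa [Finset.eq_univ_iff_forall] using hT
      exact Finset.prod_eq_zero (Finset.mem_univ i) (by simp [hi])
  rw [← hl, h, Finset.powerset_univ]
  refine Finset.sum_congr rfl fun S _ => ?_
  rw [Finset.prod_const_one, one_mul]
  split_ifs with hS
  · rw [← Finset.card_compl, ← Finset.compl_eq_univ_sdiff, ← Finset.prod_const]
    refine Finset.prod_congr rfl fun i hi => ?_
    rw [if_neg fun h => Finset.mem_compl.1 hi (hS h)]
  · obtain ⟨i, hiT, hiS⟩ := Finset.not_subset.1 hS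
    exact (Finset.prod_eq_zero (i := i) (by simp [hiS]) (by simp [hiT])).symm

/-- Inclusion-exclusion for the diagonal of a multilinear map. -/
theorem MultilinearMap.sum_neg_one_pow_card_compl_mul_map_sum
    {W : ι → Type*} [∀ r, AddCommGroup (W r)] [∀ r, Module R (W r)]
    (f : MultilinearMap R W R) (A : ι → ∀ r, W r) :
    (∑ S : Finset ι, (-1 : R) ^ (Fintype.card ι - S.card) * f fun r => ∑ i ∈ S, A i r) =
      ∑ σ : Equiv.Perm ι, f fun r => A (σ r) r := by
  calc
    _ = ∑ S : Finset ι, ∑ p : ι → ι, (if Finset.univ.image p ⊆ S then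
          (-1 : R) ^ (Fintype.card ι - S.card) else 0) * f fun r => A (p r) r := by
      refine Finset.sum_congr rfl fun S _ => ?_
      rw [f.map_sum_finset (fun r i => A i r) fun _ => S, Finset.mul_sum]
      simp_rw [ite_mul, zero_mul]
      rw [← Finset.sum_filter]
      refine Finset.sum_congr ?_ fun _ _ => rfl
      ext p
      simp [Finset.image_subset_iff]
    _ = ∑ p : ι → ι with Function.Bijective p, f fun r => A (p r) r := by
      rw [Finset.sum_comm, Finset.sum_filter]
      refine Finset.sum_congr rfl fun p _ => ?_
      rw [← Finset.sum_mul, sum_neg_one_pow_card_compl_of_subset]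
      have : Finset.univ.image p = Finset.univ ↔ Function.Bijective p := by
        rw [← Finite.surjective_iff_bijective, ← Finset.coe_eq_univ, Finset.coe_image, Finset.coe_univ,
          Set.image_univ, Set.range_eq_univ]
      simp [this]
    _ = _ :=
      Finset.sum_bij (fun p h => Equiv.ofBijective p (Finset.mem_filter.1 h).2)
        (fun _ _ => Finset.mem_univ _) (fun _ _ _ _ h => by injection h)
        (fun b _ => ⟨b, Finset.mem_filter.2 ⟨Finset.mem_univ _, b.bijective⟩,
          Equiv.coe_fn_injective rfl⟩) fun _ _ => rfl

end Inversion

section Polarization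

variable (ι R : Type*) [Fintype ι] [DecidableEq ι] [CommRing R]

/-- The mixed discriminant as a multilinear map, over an arbitrary commutative ring. -/
def polarizedDet : MultilinearMap R (fun _ : ι => Matrix ι ι R) R :=
  ∑ σ : Equiv.Perm ι, ((detRowAlternating (n := ι) (R := R)).toMultilinearMap.compLinearMap
    fun r => (LinearMap.proj r : (ι → ι → R) →ₗ[R] ι → R)).domDomCongr σ

variable {ι R}

theorem polarizedDet_apply (A : ι → Matrix ι ι R) :
    polarizedDet ι R A = ∑ σ : Equiv.Perm ι, det (of fun r => A (σ r) r) := by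
  rw [polarizedDet, _root_.sum_apply]
  rfl

theorem polarizedDet_comp_perm (A : ι → Matrix ι ι R) (τ : Equiv.Perm ι) :
    polarizedDet ι R (fun i => A (τ i)) = polarizedDet ι R A := by
  simp_rw [polarizedDet_apply]
  exact Fintype.sum_equiv (Equiv.mulLeft τ) _ _ fun σ => rfl

theorem polarizedDet_const (A : Matrix ι ι R) :
    polarizedDet ι R (fun _ => A) = (Fintype.card ι).factorial * A.det := by
  rw [polarizedDet_apply]
  change ∑ σ : Equiv.Perm ι, A.det = _
  simp [Fintype.card_perm]

theorem polarizedDet_map {S : Type*} [CommRing S] (φ : R →+* S) (A : ι → Matrix ι ι R) :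
    polarizedDet ι S (fun i => (A i).map φ) = φ (polarizedDet ι R A) := by
  simp_rw [polarizedDet_apply, map_sum, RingHom.map_det]
  rfl

theorem mixedDiscriminant_eq_polarizedDet {d : ℕ} (A : Fin d → Matrix (Fin d) (Fin d) ℝ) :
    mixedDiscriminant A = polarizedDet (Fin d) ℝ A := by
  have h := MultilinearMap.sum_neg_one_pow_card_compl_mul_map_sum
    (detRowAlternating (n := Fin d) (R := ℝ)).toMultilinearMap fun i r => A i r
  rw [polarizedDet_apply]
  refine Eq.trans ?_ h
  rw [mixedDiscriminant, Fintype.card_fin]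
  refine Finset.sum_congr rfl fun S _ => ?_
  congr 1
  change det _ = det _
  congr 1
  ext r c
  simp [Matrix.sum_apply]

end Polarization

section Line

open Polynomial

variable {ι V : Type*} [Fintype ι] [DecidableEq ι] [AddCommGroup V] [Module ℂ V]

/-- The polynomial `z ↦ f (u + z • v)`. -/
noncomputable def MultilinearMap.linePolynomial (f : MultilinearMap ℂ (fun _ : ι => V) ℂ)
    (u v : ι → V) : ℂ[X] :=
  ∑ S : Finset ι, monomial S.card (f (S.piecewise v u))

theorem MultilinearMap.eval_linePolynomial (f : MultilinearMap ℂ (fun _ : ι => V) ℂ)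
    (u v : ι → V) (z : ℂ) : (f.linePolynomial u v).eval z = f (fun i => u i + z • v i) := by
  have h := f.map_add_univ (z • v) u
  rw [add_comm] at h
  refine Eq.trans ?_ h.symm
  rw [linePolynomial, eval_finsetSum]
  refine Finset.sum_congr rfl fun S _ => ?_
  have h' := f.map_piecewise_smul (fun _ => z) (S.piecewise v u) S
  rw [Finset.prod_const, smul_eq_mul] at h'
  rw [eval_monomial, mul_comm, ← h']
  congr 1
  ext i
  by_cases hi : i ∈ S <;> simp [hi]

theorem MultilinearMap.coeff_linePolynomial (f : MultilinearMap ℂ (fun _ : ι => V) ℂ)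
    (u v : ι → V) (k : ℕ) :
    (f.linePolynomial u v).coeff k = ∑ S : Finset ι with S.card = k, f (S.piecewise v u) := by
  rw [linePolynomial, finsetSum_coeff, Finset.sum_filter]
  simp only [coeff_monomial]

theorem MultilinearMap.eval_zero_derivative_linePolynomial
    (f : MultilinearMap ℂ (fun _ : ι => V) ℂ) (u v : ι → V) :
    (f.linePolynomial u v).derivative.eval 0 = ∑ i, f (Function.update u i (v i)) := by
  rw [← coeff_zero_eq_eval_zero, coeff_derivative, coeff_linePolynomial]
  simp only [zero_add, Nat.cast_zero, mul_one]
  have : (Finset.univ.filter fun S : Finset ι => S.card = 1) =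
      Finset.univ.map ⟨singleton, Finset.singleton_injective⟩ := by
    ext S
    simp [Finset.card_eq_one, eq_comm]
  rw [this, Finset.sum_map]
  simp [Finset.piecewise_singleton]

/-- If a complex polynomial has no zeros in the closed upper half plane and is not constant, then
neither has its derivative. -/
theorem Polynomial.eval_derivative_ne_zero_of_im_nonneg {P : ℂ[X]} (hP : 0 < P.degree)
    (h : ∀ z : ℂ, 0 ≤ z.im → P.eval z ≠ 0) {z : ℂ} (hz : 0 ≤ z.im) :
    P.derivative.eval z ≠ 0 := by
  intro h0
  have hd : P.derivative ≠ 0 := fun h' => by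
    have := derivative_eq_zero.1 h'
    rw [← natDegree_pos_iff_degree_pos] at hP
    omega
  have hmem : z ∈ P.derivative.rootSet ℂ := by
    rw [mem_rootSet]
    exact ⟨hd, by simpa using h0⟩
  have hsub : P.rootSet ℂ ⊆ {c : ℂ | c.im < 0} := fun w hw => by
    rw [mem_rootSet] at hw
    by_contra hw'
    exact h w (not_lt.1 hw') (by simpa using hw.2)
  have := convexHull_min hsub (convex_halfSpace_im_lt 0)
    (rootSet_derivative_subset_convexHull_rootSet hP hmem)
  exact absurd this (not_lt.2 hz)

end Line

section Stability

open Complex Polynomial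
open scoped ComplexOrder MatrixOrder

variable {ι : Type*} [Fintype ι] [DecidableEq ι]

theorem Matrix.PosDef.map_ofReal {A : Matrix ι ι ℝ} (hA : A.PosDef) :
    (A.map (Complex.ofReal)).PosDef := by
  have hpsd : (A.map Complex.ofReal).PosSemidef := by
    obtain ⟨m, v, rfl⟩ := posSemidef_iff_eq_sum_vecMulVec.1 hA.posSemidef
    refine posSemidef_iff_eq_sum_vecMulVec.2 ⟨m, fun i j => (v i j : ℂ), ?_⟩
    ext j k
    simp [Matrix.sum_apply, vecMulVec_apply]
  rw [hpsd.posDef_iff_isUnit]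
  exact hA.isUnit.map (Complex.ofRealHom.mapMatrix (m := ι))

theorem Matrix.IsHermitian.det_add_I_smul_ne_zero {X P : Matrix ι ι ℂ} (hX : X.IsHermitian)
    (hP : P.PosDef) : (X + I • P).det ≠ 0 := by
  intro h
  obtain ⟨v, hv, h0⟩ := exists_mulVec_eq_zero_iff.2 h
  have h1 : star v ⬝ᵥ (X *ᵥ v) + I * (star v ⬝ᵥ (P *ᵥ v)) = 0 := by
    have := congrArg (star v ⬝ᵥ ·) h0
    simpa [add_mulVec, smul_mulVec, dotProduct_add, dotProduct_smul] using this
  have h2 := hX.im_star_dotProduct_mulVec_self v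
  have h3 := (Complex.pos_iff.1 (hP.dotProduct_mulVec_pos hv)).1
  have h4 := congrArg Complex.im h1
  simp only [add_im, I_mul_im, zero_im] at h4
  simp only [RCLike.im_to_complex] at h2
  linarith

/-- Mixed discriminants with some arguments positive definite and the others equal to a common
matrix with positive definite imaginary part do not vanish. -/
theorem polarizedDet_piecewise_ne_zero {B : ι → Matrix ι ι ℂ} (hB : ∀ i, (B i).PosDef)
    (s : Finset ι) {X P : Matrix ι ι ℂ} (hX : X.IsHermitian) (hP : P.PosDef) :
    polarizedDet ι ℂ (s.piecewise B fun _ => X + I • P) ≠ 0 := by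
  induction s using Finset.induction_on generalizing X P with
  | empty =>
    rw [Finset.piecewise_empty, polarizedDet_const]
    exact mul_ne_zero (Nat.cast_ne_zero.2 (Nat.factorial_ne_zero _))
      (hX.det_add_I_smul_ne_zero hP)
  | insert a s ha ih =>
    set u : ι → Matrix ι ι ℂ := s.piecewise B fun _ => X + I • P with hu
    set v : ι → Matrix ι ι ℂ := s.piecewise 0 fun _ => B a with hv
    set Q := (polarizedDet ι ℂ).linePolynomial u v with hQ
    have hroots : ∀ z : ℂ, 0 ≤ z.im → Q.eval z ≠ 0 := fun z hz => by
      have hX' : (X + (z.re : ℂ) • B a).IsHermitian :=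
        hX.add ((hB a).isHermitian.smul (by simp [isSelfAdjoint_iff]))
      have hP' : (P + (z.im : ℂ) • B a).PosDef :=
        hP.add_posSemidef ((hB a).posSemidef.smul (by exact_mod_cast hz))
      convert ih hX' hP' using 1
      rw [hQ, MultilinearMap.eval_linePolynomial]
      congr 1
      ext1 i
      by_cases hi : i ∈ s
      · simp [hu, hv, hi]
      · simp only [hu, hv, hi, not_false_eq_true, Finset.piecewise_eq_of_notMem]
        nth_rw 1 [← re_add_im z]
        module
    have hlead : polarizedDet ι ℂ (s.piecewise B fun _ => B a) ≠ 0 := fun h => by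
      have h' := (polarizedDet ι ℂ).map_piecewise_smul (fun _ => I)
        (s.piecewise B fun _ => B a) sᶜ
      rw [h, smul_zero] at h'
      refine ih isHermitian_zero (hB a) ?_
      rw [← h']
      congr 1
      ext1 i
      by_cases hi : i ∈ s <;> simp [hi]
    have hcoeff : Q.coeff sᶜ.card ≠ 0 := by
      rw [hQ, MultilinearMap.coeff_linePolynomial,
        Finset.sum_eq_single_of_mem sᶜ (by simp) fun S hS hne => ?_]
      · convert hlead using 2
        ext1 i
        by_cases hi : i ∈ s <;> simp [hu, hv, hi]
      · have hnot : ¬ S ⊆ sᶜ := fun h =>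
          hne (Finset.eq_of_subset_of_card_le h (Finset.mem_filter.1 hS).2.ge)
        obtain ⟨i, hiS, his⟩ := Finset.not_subset.1 hnot
        refine (polarizedDet ι ℂ).map_coord_zero i ?_
        simp [hiS, hv, Finset.notMem_compl.1 his]
    have hdeg : 0 < Q.degree := by
      rw [← natDegree_pos_iff_degree_pos]
      exact (Finset.card_pos.2 ⟨a, by simpa using ha⟩).trans_le (le_natDegree_of_ne_zero hcoeff)
    intro h
    refine eval_derivative_ne_zero_of_im_nonneg hdeg hroots (z := 0) (by simp) ?_
    rw [hQ, MultilinearMap.eval_zero_derivative_linePolynomial]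
    refine Finset.sum_eq_zero fun i _ => ?_
    by_cases hi : i ∈ s
    · exact (polarizedDet ι ℂ).map_coord_zero i (by simp [hv, hi])
    · rw [← h, ← polarizedDet_comp_perm _ (Equiv.swap a i), Finset.piecewise_insert]
      congr 1
      ext1 j
      rcases eq_or_ne j a with rfl | hja
      · simp [hv, hi]
      rcases eq_or_ne j i with rfl | hji
      · simp [hja, hu, ha, hi, hja.symm]
      · simp [Equiv.swap_apply_of_ne_of_ne hja hji, hja, hji, hu]

end Stability

section Quadratic

/-- A real quadratic form without zeros `(1, z)` in the open upper half plane has nonnegative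
discriminant. -/
theorem mul_le_sq_of_forall_im_pos_ne_zero {a b c : ℝ}
    (h : ∀ z : ℂ, 0 < z.im → (a : ℂ) + 2 * z * b + z ^ 2 * c ≠ 0) : a * c ≤ b ^ 2 := by
  by_contra! hlt
  have hc : c ≠ 0 := by
    rintro rfl
    nlinarith [sq_nonneg b]
  have hδ : 0 < √(a * c - b ^ 2) := Real.sqrt_pos.2 (sub_pos.2 hlt)
  have hsq := Real.sq_sqrt (sub_pos.2 hlt).le
  set δ := √(a * c - b ^ 2)
  refine h ⟨-b / c, δ / |c|⟩ (div_pos hδ (abs_pos.2 hc)) ?_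
  have habs : (δ / |c|) ^ 2 = δ ^ 2 / c ^ 2 := by rw [div_pow, sq_abs]
  apply Complex.ext
  · simp [pow_two] at habs hsq ⊢
    have : -b / c * (-b / c) - δ / |c| * (δ / |c|) = (b * b - δ * δ) / (c * c) := by
      rw [habs]; field_simp
    rw [this, hsq]
    field_simp
    ring
  · simp [pow_two]
    field_simp
    ring

end Quadratic

open scoped ComplexOrder in
/-- The inequality for positive definite matrices. -/
theorem mixedDiscriminant_alexandrov_fenchel_of_posDef (n : ℕ)
    (A : Fin (n + 2) → Matrix (Fin (n + 2)) (Fin (n + 2)) ℝ) (hA : ∀ i, (A i).PosDef) :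
    mixedDiscriminant (Function.update A 1 (A 0)) * mixedDiscriminant (Function.update A 0 (A 1)) ≤
      mixedDiscriminant A ^ 2 := by
  simp_rw [mixedDiscriminant_eq_polarizedDet]
  refine mul_le_sq_of_forall_im_pos_ne_zero fun z hz => ?_
  set B : Fin (n + 2) → Matrix (Fin (n + 2)) (Fin (n + 2)) ℂ :=
    fun i => (A i).map Complex.ofRealHom with hBdef
  have hB : ∀ i, (B i).PosDef := fun i => (hA i).map_ofReal
  have hX : (B 0 + (z.re : ℂ) • B 1).IsHermitian :=
    (hB 0).isHermitian.add ((hB 1).isHermitian.smul (by simp [isSelfAdjoint_iff]))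
  have hP : ((z.im : ℂ) • B 1).PosDef := (hB 1).smul (by exact_mod_cast hz)
  have key := polarizedDet_piecewise_ne_zero hB {0, 1}ᶜ hX hP
  have hZ : B 0 + (z.re : ℂ) • B 1 + Complex.I • (z.im : ℂ) • B 1 = B 0 + z • B 1 := by
    nth_rw 3 [← Complex.re_add_im z]
    module
  rw [hZ] at key
  have hpw : Finset.piecewise {0, 1}ᶜ B (fun _ => B 0 + z • B 1) =
      Function.update (Function.update B 0 (B 0 + z • B 1)) 1 (B 0 + z • B 1) := by
    ext1 i
    rcases eq_or_ne i 0 with rfl | h0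
    · simp
    rcases eq_or_ne i 1 with rfl | h1
    · simp
    · simp [h0, h1]
  have hcast : ∀ C : Fin (n + 2) → Matrix (Fin (n + 2)) (Fin (n + 2)) ℝ,
      ((polarizedDet _ ℝ C : ℝ) : ℂ) =
        polarizedDet _ ℂ fun i => (C i).map Complex.ofRealHom :=
    fun C => (polarizedDet_map Complex.ofRealHom C).symm
  have hup : ∀ i M, (fun j => (Function.update A i M j).map Complex.ofRealHom) =
      Function.update B i (M.map Complex.ofRealHom) := fun i M => by
    ext1 j
    rcases eq_or_ne j i with rfl | h <;> simp [*]
  have hswap : polarizedDet _ ℂ (Function.update (Function.update B 1 (B 0)) 0 (B 1)) =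
      polarizedDet _ ℂ B := by
    rw [← polarizedDet_comp_perm B (Equiv.swap 0 1)]
    congr 1
    ext1 i
    rcases eq_or_ne i 0 with rfl | h0
    · simp
    rcases eq_or_ne i 1 with rfl | h1
    · simp
    · simp [h0, h1, Equiv.swap_apply_of_ne_of_ne h0 h1]
  rw [hcast, hcast, hcast, hup, hup, ← hBdef]
  change polarizedDet _ ℂ (Function.update B 1 (B 0)) + 2 * z * polarizedDet _ ℂ B +
    z ^ 2 * polarizedDet _ ℂ (Function.update B 0 (B 1)) ≠ 0
  convert key using 1
  have h01 : (0 : Fin (n + 2)) ≠ 1 := by simp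
  rw [hpw, MultilinearMap.map_update_add, MultilinearMap.map_update_smul,
    Function.update_comm h01, Function.update_comm h01]
  simp only [MultilinearMap.map_update_add, MultilinearMap.map_update_smul]
  have h00 : Function.update (Function.update B 1 (B 0)) 0 (B 0) = Function.update B 1 (B 0) := by
    rw [Function.update_comm h01.symm, Function.update_eq_self]
  rw [hswap, h00]
  simp only [Function.update_eq_self, smul_eq_mul]
  ring

theorem continuous_mixedDiscriminant {d : ℕ} :
    Continuous (mixedDiscriminant : (Fin d → Matrix (Fin d) (Fin d) ℝ) → ℝ) := by
  unfold mixedDiscriminant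
  refine continuous_finsetSum _ fun S _ => continuous_const.mul (Continuous.matrix_det ?_)
  fun_prop

/-- for `d = n + 2 ≥ 2` positive semidefinite real symmetric `d × d` matrices
`A_1, …, A_d`, one has
`D(A_1, A_2, A_3, …, A_d)^2 ≥ D(A_1, A_1, A_3, …, A_d) ⬝ D(A_2, A_2, A_3, …, A_d)`. -/
theorem mixedDiscriminant_alexandrov_fenchel (n : ℕ)
    (A : Fin (n + 2) → Matrix (Fin (n + 2)) (Fin (n + 2)) ℝ)
    (hAsymm : ∀ i, (A i).IsSymm) (hApsd : ∀ i, (A i).PosSemidef) :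
    mixedDiscriminant A ^ 2 ≥
      mixedDiscriminant (Function.update A 1 (A 0)) *
        mixedDiscriminant (Function.update A 0 (A 1)) := by
  let C : ℝ → Fin (n + 2) → Matrix (Fin (n + 2)) (Fin (n + 2)) ℝ := fun ε i => A i + ε • 1
  have hC : Continuous C := by fun_prop
  have hC0 : C 0 = A := by
    ext1 i
    simp [C]
  have hle : ∀ ε ∈ Set.Ioi (0 : ℝ),
      mixedDiscriminant (Function.update (C ε) 1 (C ε 0)) *
        mixedDiscriminant (Function.update (C ε) 0 (C ε 1)) ≤ mixedDiscriminant (C ε) ^ 2 :=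
    fun ε hε => mixedDiscriminant_alexandrov_fenchel_of_posDef n (C ε) fun i =>
      PosDef.posSemidef_add (hApsd i) (PosDef.one.smul hε)
  have hcl : IsClosed {ε : ℝ | mixedDiscriminant (Function.update (C ε) 1 (C ε 0)) *
      mixedDiscriminant (Function.update (C ε) 0 (C ε 1)) ≤ mixedDiscriminant (C ε) ^ 2} :=
    isClosed_le
      ((continuous_mixedDiscriminant.comp (hC.update 1 ((continuous_apply 0).comp hC))).mul
        (continuous_mixedDiscriminant.comp (hC.update 0 ((continuous_apply 1).comp hC))))
      ((continuous_mixedDiscriminant.comp hC).pow 2)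
  have h0 : mixedDiscriminant (Function.update (C 0) 1 (C 0 0)) *
      mixedDiscriminant (Function.update (C 0) 0 (C 0 1)) ≤ mixedDiscriminant (C 0) ^ 2 :=
    closure_minimal hle hcl (by simp : (0 : ℝ) ∈ closure (Set.Ioi 0))
  rwa [hC0] at h0
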